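/- Let W = W(k) be the ring of Witt vectors of a perfect field k, let X be a smooth affine W-scheme with coordinate ring R, and let R̂ be the p-adic completion of R. Let f ∈ R̂[1/p]. Suppose there is a Zariski-dense subset U₀ of the special fibre Spec(R ⊗_W k) such that each closed point x₀ ∈ U₀ admits a lift x̃₀: R̂ → W(κ(x₀)) with x̃₀(f) ∈ W(κ(x₀)). Then f ∈ R̂. -/

import Mathlib

/-!
STATEMENT 8: Let W = W(k) be the Witt vectors of a perfect field k, R a smooth affine
W-algebra, R̂ its p-adic completion, and f = g/pⁿ ∈ R̂[1/p]. If there is a Zariski-dense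
subset U₀ of the special fibre Spec (R/p) of closed points x₀ admitting lifts
xt : R̂ → W(κ(x₀)) (as W-algebra maps reducing to x₀ mod p) with xt(f) ∈ W(κ(x₀)),
then f ∈ R̂, i.e. g is divisible by pⁿ in R̂.
-/

open WittVector

noncomputable section

section Aux

open TensorProduct

theorem smooth_reduced (K S : Type*) [Field K] [CommRing S] [Algebra K S] [Algebra.Smooth K S] :
    IsReduced S := by
  refine ⟨fun a ha => ?_⟩
  have hn : IsNilpotent (a ⊗ₜ[K] (Polynomial.X : Polynomial K)) := by
    obtain ⟨m, hm⟩ := ha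
    exact ⟨m, by rw [Algebra.TensorProduct.tmul_pow, hm, zero_tmul]⟩
  have hint : IsIntegral S (a ⊗ₜ[K] (Polynomial.X : Polynomial K)) := by
    obtain ⟨m, hm⟩ := hn
    refine ⟨Polynomial.X ^ m, Polynomial.monic_X_pow m, by simp [hm]⟩
  obtain ⟨z, hz⟩ := (TensorProduct.toIntegralClosure_bijective_of_smooth (R := K) (S := S)
    (B := Polynomial K)).2 ⟨_, hint⟩
  have hz' : Algebra.TensorProduct.map (.id S S) (integralClosure K (Polynomial K)).val z
      = a ⊗ₜ[K] (Polynomial.X : Polynomial K) := congrArg Subtype.val hz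
  let ev (c : K) : S ⊗[K] Polynomial K →ₐ[K] S :=
    Algebra.TensorProduct.lift (AlgHom.id K S) ((Algebra.ofId K S).comp (Polynomial.aeval c))
      (fun _ _ => Commute.all _ _)
  have key : ∀ z : S ⊗[K] integralClosure K (Polynomial K),
     ev 0 (Algebra.TensorProduct.map (.id S S) (integralClosure K (Polynomial K)).val z) =
     ev 1 (Algebra.TensorProduct.map (.id S S) (integralClosure K (Polynomial K)).val z) := by
    intro z
    induction z with
    | zero => simp
    | add x y hx hy => simp only [map_add, hx, hy]
    | tmul s b =>
      obtain ⟨b, hb⟩ := b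
      obtain ⟨c, rfl⟩ : ∃ c, Polynomial.C c = b := by
        by_contra hc
        have hd : 0 < b.natDegree := by
          rw [Nat.pos_iff_ne_zero]
          intro h0
          exact hc ⟨_, (Polynomial.eq_C_of_natDegree_eq_zero h0).symm⟩
        obtain ⟨q, hq, hq0⟩ := (hb : IsIntegral K b)
        have hq1 : q.comp b = 0 := by
          rw [← hq0]; rfl
        have h2 := congrArg Polynomial.natDegree hq1
        rw [Polynomial.natDegree_comp, Polynomial.natDegree_zero, Nat.mul_eq_zero] at h2
        have hq2 : q.natDegree = 0 := by omega
        rw [hq.natDegree_eq_zero.mp hq2] at hq1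
        simp at hq1
      simp [ev]
  have := key z
  rw [hz'] at this
  simpa [ev] using this.symm

theorem quot_reduced (p : ℕ) [Fact p.Prime]
    (k : Type) [Field k] [CharP k p] [PerfectRing k p]
    (R : Type) [CommRing R] [Algebra (WittVector p k) R]
    [Algebra.Smooth (WittVector p k) R] : IsReduced (R ⧸ Ideal.span {(p : R)}) := by
  let J : Ideal (WittVector p k) := Ideal.span {(p : WittVector p k)}
  have hJ : J.IsMaximal := PrincipalIdealRing.isMaximal_of_irreducible (WittVector.irreducible p)
  let _ := Ideal.Quotient.field J
  have h := smooth_reduced (WittVector p k ⧸ J) ((WittVector p k ⧸ J) ⊗[WittVector p k] R)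
  have e : J.map (algebraMap (WittVector p k) R) = Ideal.span {(p : R)} := by
    simp [J, Ideal.map_span]
  rw [← e]
  exact isReduced_of_injective _
    ((Algebra.TensorProduct.quotIdealMapEquivQuotTensor R J)).injective

end Aux

theorem padic_completion_integrality
    (p : ℕ) [Fact p.Prime]
    (k : Type) [Field k] [ExpChar k p] [PerfectRing k p]
    (R : Type) [CommRing R] [Algebra (WittVector p k) R]
    [Algebra.Smooth (WittVector p k) R]
    -- the p-adic completion R̂ of R
    (I : Ideal R) (hI : I = Ideal.span {(p : R)})
    -- the element f = g / p^n of R̂[1/p]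
    (g : AdicCompletion I R) (n : ℕ)
    -- a Zariski-dense set U₀ of closed points of the special fibre Spec (R/I)
    (U₀ : Set (PrimeSpectrum (R ⧸ I))) (hdense : Dense U₀)
    (hU₀ : ∀ x₀ ∈ U₀, x₀.asIdeal.IsMaximal ∧
      -- a lift xt of x₀ to a W-algebra map R̂ → W(κ(x₀))
      ∃ (χ : k →+* ((R ⧸ I) ⧸ x₀.asIdeal))
        (xt : AdicCompletion I R →+* WittVector p ((R ⧸ I) ⧸ x₀.asIdeal)),
        -- xt is a W-algebra map (for the Witt functorial structure map W(k) → W(κ(x₀)))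
        xt.comp ((algebraMap R (AdicCompletion I R)).comp
            (algebraMap (WittVector p k) R)) = WittVector.map χ ∧
        -- xt reduces to the point x₀ modulo p
        (WittVector.constantCoeff).comp (xt.comp (algebraMap R (AdicCompletion I R))) =
          (Ideal.Quotient.mk x₀.asIdeal).comp (Ideal.Quotient.mk I) ∧
        -- xt(f) = xt(g)/pⁿ lies in W(κ(x₀))
        ∃ w : WittVector p ((R ⧸ I) ⧸ x₀.asIdeal), xt g = (p : WittVector p _) ^ n * w) :
    -- then f = g/pⁿ lies in R̂
    ∃ h : AdicCompletion I R, g = (p : AdicCompletion I R) ^ n * h := by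
  have hchar : CharP k p := by
    rcases ‹ExpChar k p› with _ | _
    · exact absurd rfl (Fact.out : Nat.Prime 1).ne_one
    · assumption
  have hred : IsReduced (R ⧸ I) := by rw [hI]; exact quot_reduced p k R
  have hfg : I.FG := by rw [hI]; exact ⟨{(p : R)}, by simp⟩
  have hker : ∀ x : AdicCompletion I R, AdicCompletion.evalOneₐ I x = 0 →
      ∃ y, x = (p : AdicCompletion I R) * y := by
    intro x hx
    have : x ∈ RingHom.ker (AdicCompletion.evalOneₐ I).toRingHom := hx
    rw [AdicCompletion.ker_evalOneₐ_eq_map I hfg,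
      congrArg (Ideal.map (algebraMap R (AdicCompletion I R))) hI, Ideal.map_span, Set.image_singleton,
      Ideal.mem_span_singleton] at this
    obtain ⟨y, hy⟩ := this
    exact ⟨y, by simpa using hy⟩
  suffices H : ∀ m ≤ n, ∃ h : AdicCompletion I R, g = (p : AdicCompletion I R) ^ m * h from
    H n le_rfl
  intro m
  induction m with
  | zero => exact fun _ => ⟨g, by simp⟩
  | succ m ih =>
    intro hm
    obtain ⟨h, hh⟩ := ih (by omega)
    suffices h0 : AdicCompletion.evalOneₐ I h = 0 by
      obtain ⟨y, rfl⟩ := hker h h0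
      exact ⟨y, by rw [hh]; ring⟩
    obtain ⟨r, hr⟩ := Ideal.Quotient.mk_surjective (AdicCompletion.evalOneₐ I h)
    rw [← hr]
    have hmem : ∀ x₀ ∈ U₀, Ideal.Quotient.mk I r ∈ x₀.asIdeal := by
      intro x₀ hx₀
      obtain ⟨hmax, χ, xt, -, h2, w, hw⟩ := hU₀ x₀ hx₀
      have : CharP ((R ⧸ I) ⧸ x₀.asIdeal) p := charP_of_injective_ringHom χ.injective p
      have hp0 : (p : WittVector p ((R ⧸ I) ⧸ x₀.asIdeal)) ≠ 0 := WittVector.p_nonzero p _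
      have hxh : xt h = (p : WittVector p ((R ⧸ I) ⧸ x₀.asIdeal)) * (p ^ (n - m - 1) * w) := by
        apply mul_left_cancel₀ (pow_ne_zero m hp0)
        have : xt g = (p : WittVector p ((R ⧸ I) ⧸ x₀.asIdeal)) ^ m * xt h := by
          rw [hh]; simp
        rw [← this, hw]
        obtain ⟨d, rfl⟩ := Nat.exists_eq_add_of_le hm
        rw [show m + 1 + d - m - 1 = d by omega]
        ring
      have hp1 : WittVector.constantCoeff (p : WittVector p ((R ⧸ I) ⧸ x₀.asIdeal)) = 0 := by
        simp
      obtain ⟨y, hy⟩ := hker (h - algebraMap R _ r) (by rw [map_sub, ← hr]; simp)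
      have hr' : algebraMap R (AdicCompletion I R) r = h - p * y := by rw [← hy]; ring
      have h3 := congrArg (fun f : R →+* _ => f r) h2
      simp only [RingHom.comp_apply] at h3
      rw [hr', map_sub, map_mul, hxh, map_natCast, map_sub, map_mul, map_mul, hp1, map_mul,
        hp1, zero_mul, zero_mul, sub_zero] at h3
      rw [← Ideal.Quotient.eq_zero_iff_mem, ← h3]
    have hz : U₀ ⊆ PrimeSpectrum.zeroLocus {Ideal.Quotient.mk I r} := fun x hx => by
      simpa [PrimeSpectrum.mem_zeroLocus] using hmem x hx
    have hcl := (PrimeSpectrum.isClosed_zeroLocus {Ideal.Quotient.mk I r}).closure_subset_iff.mpr hz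
    rw [hdense.closure_eq] at hcl
    apply IsNilpotent.eq_zero
    rw [nilpotent_iff_mem_prime]
    intro J hJ
    simpa [PrimeSpectrum.mem_zeroLocus] using hcl (Set.mem_univ (⟨J, hJ⟩ : PrimeSpectrum _))

end
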